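/- Every Lagrangian K[ε]-submodule L ⊆ V ⊕ εV is of the form L_{F,φ} := { f + εv : f ∈ F, v ∈ V, v + F^⊥ = φ(f) } for a unique pair (F, φ), where F ⊆ V is an isotropic subspace and φ : F → V/F^⊥ is a skew-symmetric linear map; i.e. (F, φ) ↦ L_{F,φ} is a bijection from the set of such pairs onto the set of all Lagrangian K[ε]-submodules of V ⊕ εV. Moreover, necessarily dim_K F ≤ ⌊r/2⌋. -/

import Mathlib

/-!
STATEMENT 12: Every Lagrangian `K[ε]`-submodule `L ⊆ V ⊕ εV` is of the form
`L_{F,φ} := { f + εv : f ∈ F, v ∈ V, v + F^⊥ = φ(f) }` for a unique pair `(F, φ)`, where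
`F ⊆ V` is an isotropic subspace and `φ : F → V/F^⊥` is a skew-symmetric linear map; i.e.
`(F, φ) ↦ L_{F,φ}` is a bijection from the set of such pairs onto the set of all Lagrangian
`K[ε]`-submodules of `V ⊕ εV`.  Moreover, necessarily `dim_K F ≤ ⌊r/2⌋`.

We model `V ⊕ εV` as `V × V`, `(a, b) ↔ a + ε b`, with `ε`-action `eps : (a,b) ↦ (0,a)`,
`π` the first projection; `b₂` is the `K[ε]`-bilinear extension of `b₁` with values in
`K[ε] = K × K`.  The bijectivity is expressed by: (i) each pair `(F, φ)` (with `F` isotropic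
and `φ` skew-symmetric) yields a Lagrangian submodule with underlying set `L_{F,φ}`, whose
`F` satisfies `dim_K F ≤ ⌊r/2⌋`; (ii) for every Lagrangian submodule `L` there is a unique
such pair `(F, φ)` with underlying set of `L` equal to `L_{F,φ}`.
-/

/-- Multiplication by `ε` on `V ⊕ εV ≅ V × V`: `(a, b) ↦ (0, a)`. -/
noncomputable abbrev eps (K V : Type*) [Field K] [AddCommGroup V] [Module K V] :
    V × V →ₗ[K] V × V :=
  (LinearMap.inr K V V) ∘ₗ (LinearMap.fst K V V)

/-- The `K[ε]`-bilinear extension `b₂` of a bilinear form `b₁` on `V` to `V ⊕ εV`. -/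
noncomputable def b2 {K V : Type*} [Field K] [AddCommGroup V] [Module K V]
    (b₁ : V →ₗ[K] V →ₗ[K] K) : (V × V) →ₗ[K] (V × V) →ₗ[K] K × K :=
  LinearMap.mk₂ K (fun x y => (b₁ x.1 y.1, b₁ x.1 y.2 + b₁ x.2 y.1))
    (fun m m' n => by simp [Prod.ext_iff]; ring)
    (fun c m n => by simp [Prod.ext_iff]; ring)
    (fun m n n' => by simp [Prod.ext_iff]; ring)
    (fun c m n => by simp [Prod.ext_iff]; ring)

/-- The orthogonal complement `F^⊥ = {v ∈ V : b₁(v, f) = 0 ∀ f ∈ F}`. -/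
def perp {K V : Type*} [Field K] [AddCommGroup V] [Module K V]
    (b₁ : V →ₗ[K] V →ₗ[K] K) (F : Submodule K V) : Submodule K V where
  carrier := {v | ∀ f ∈ F, b₁ v f = 0}
  add_mem' := by
    intro a b ha hb f hf
    simp [ha f hf, hb f hf]
  zero_mem' := by
    intro f hf
    simp
  smul_mem' := by
    intro c a ha f hf
    simp [ha f hf]

/-- Skew-symmetric linear maps `φ : F → V/F^⊥`. -/
def Skew {K V : Type*} [Field K] [AddCommGroup V] [Module K V]
    (b₁ : V →ₗ[K] V →ₗ[K] K) (F : Submodule K V) :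
    Set (↥F →ₗ[K] V ⧸ perp b₁ F) :=
  {φ | ∀ (f f' : ↥F) (v v' : V),
    Submodule.Quotient.mk v = φ f → Submodule.Quotient.mk v' = φ f' →
    b₁ v f' = - b₁ v' f}

/-- The set `L_{F,φ} = { f + εv : f ∈ F, v ∈ V, v + F^⊥ = φ(f) } ⊆ V ⊕ εV`. -/
def Lset {K V : Type*} [Field K] [AddCommGroup V] [Module K V]
    (b₁ : V →ₗ[K] V →ₗ[K] K) (F : Submodule K V) (φ : ↥F →ₗ[K] V ⧸ perp b₁ F) :
    Set (V × V) :=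
  {x | ∃ h : x.1 ∈ F, Submodule.Quotient.mk x.2 = φ ⟨x.1, h⟩}

section

variable {K V : Type*} [Field K] [AddCommGroup V] [Module K V]

lemma mem_perp {b₁ : V →ₗ[K] V →ₗ[K] K} {F : Submodule K V} {v : V} :
    v ∈ perp b₁ F ↔ ∀ f ∈ F, b₁ v f = 0 :=
  Iff.rfl

lemma b2_eq_zero_iff {b₁ : V →ₗ[K] V →ₗ[K] K} {x y : V × V} :
    b2 b₁ x y = 0 ↔ b₁ x.1 y.1 = 0 ∧ b₁ x.1 y.2 + b₁ x.2 y.1 = 0 := by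
  simp [b2, Prod.ext_iff]

lemma finrank_add_finrank_perp [FiniteDimensional K V] {b₁ : V →ₗ[K] V →ₗ[K] K}
    (hsymm : ∀ v w : V, b₁ v w = b₁ w v)
    (hnd : ∀ v : V, (∀ w : V, b₁ v w = 0) → v = 0) (F : Submodule K V) :
    Module.finrank K F + Module.finrank K (perp b₁ F) = Module.finrank K V := by
  have hperp : perp b₁ F = LinearMap.BilinForm.orthogonal b₁ F := by
    ext v
    simp only [mem_perp, LinearMap.BilinForm.mem_orthogonal_iff, hsymm v]
  have hb : b₁.Nondegenerate :=
    ⟨hnd, fun v hv => hnd v fun w => (hsymm v w).trans (hv w)⟩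
  have h := LinearMap.BilinForm.finrank_orthogonal hb F
  have hle := F.finrank_le
  rw [hperp]
  omega

/-- A subspace of `V × V` has the dimension of its first projection plus that of its intersection
with `0 × V`. -/
lemma finrank_map_fst_add_finrank_comap_inr [FiniteDimensional K V] (L : Submodule K (V × V)) :
    Module.finrank K (L.map (LinearMap.fst K V V)) +
      Module.finrank K (L.comap (LinearMap.inr K V V)) = Module.finrank K L := by
  let g := (LinearMap.fst K V V).domRestrict L
  let i : L.comap (LinearMap.inr K V V) →ₗ[K] L :=
    (LinearMap.inr K V V).restrict fun _ h => h
  have hi : Function.Injective i := fun a b h =>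
    Subtype.ext (congrArg Prod.snd (congrArg Subtype.val h))
  have hrange : LinearMap.range g = L.map (LinearMap.fst K V V) :=
    LinearMap.range_domRestrict L _
  have hker : LinearMap.ker g = LinearMap.range i := by
    ext ⟨⟨a, v⟩, h⟩
    constructor
    · intro ha
      obtain rfl : a = 0 := ha
      exact ⟨⟨v, h⟩, rfl⟩
    · rintro ⟨w, hw⟩
      exact (congrArg (fun z : L => z.1.1) hw).symm
  rw [← g.finrank_range_add_finrank_ker, hrange, hker, LinearMap.finrank_range_of_inj hi]

/-- `L_{F,φ}` as a `K`-subspace of `V × V`. -/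
def lagrangianOf (b₁ : V →ₗ[K] V →ₗ[K] K) (F : Submodule K V)
    (φ : ↥F →ₗ[K] V ⧸ perp b₁ F) : Submodule K (V × V) where
  carrier := Lset b₁ F φ
  add_mem' := by
    rintro x y ⟨hx, hx'⟩ ⟨hy, hy'⟩
    refine ⟨F.add_mem hx hy, ?_⟩
    have h := φ.map_add ⟨x.1, hx⟩ ⟨y.1, hy⟩
    rw [← hx', ← hy'] at h
    exact h.symm
  zero_mem' := ⟨F.zero_mem, φ.map_zero.symm⟩
  smul_mem' := by
    rintro c x ⟨hx, hx'⟩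
    refine ⟨F.smul_mem c hx, ?_⟩
    have h := φ.map_smul c ⟨x.1, hx⟩
    rw [← hx'] at h
    exact h.symm

lemma mem_lagrangianOf {b₁ : V →ₗ[K] V →ₗ[K] K} {F : Submodule K V}
    {φ : ↥F →ₗ[K] V ⧸ perp b₁ F} {x : V × V} :
    x ∈ lagrangianOf b₁ F φ ↔ ∃ h : x.1 ∈ F, Submodule.Quotient.mk x.2 = φ ⟨x.1, h⟩ :=
  Iff.rfl

lemma map_fst_lagrangianOf (b₁ : V →ₗ[K] V →ₗ[K] K) (F : Submodule K V)
    (φ : ↥F →ₗ[K] V ⧸ perp b₁ F) :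
    (lagrangianOf b₁ F φ).map (LinearMap.fst K V V) = F := by
  ext f
  constructor
  · rintro ⟨x, ⟨hx, -⟩, rfl⟩
    exact hx
  · intro hf
    obtain ⟨v, hv⟩ := Submodule.Quotient.mk_surjective _ (φ ⟨f, hf⟩)
    exact ⟨(f, v), ⟨hf, hv⟩, rfl⟩

lemma comap_inr_lagrangianOf (b₁ : V →ₗ[K] V →ₗ[K] K) (F : Submodule K V)
    (φ : ↥F →ₗ[K] V ⧸ perp b₁ F) :
    (lagrangianOf b₁ F φ).comap (LinearMap.inr K V V) = perp b₁ F := by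
  ext v
  have h0 : φ ⟨0, F.zero_mem⟩ = 0 := φ.map_zero
  rw [Submodule.mem_comap, mem_lagrangianOf, ← Submodule.Quotient.mk_eq_zero (perp b₁ F)]
  simp [h0]

lemma finrank_lagrangianOf [FiniteDimensional K V] {b₁ : V →ₗ[K] V →ₗ[K] K}
    (hsymm : ∀ v w : V, b₁ v w = b₁ w v)
    (hnd : ∀ v : V, (∀ w : V, b₁ v w = 0) → v = 0) (F : Submodule K V)
    (φ : ↥F →ₗ[K] V ⧸ perp b₁ F) :
    Module.finrank K (lagrangianOf b₁ F φ) = Module.finrank K V := by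
  rw [← finrank_map_fst_add_finrank_comap_inr, map_fst_lagrangianOf, comap_inr_lagrangianOf,
    finrank_add_finrank_perp hsymm hnd]

lemma Lset_injective (b₁ : V →ₗ[K] V →ₗ[K] K) :
    Function.Injective fun p : (F : Submodule K V) × (↥F →ₗ[K] V ⧸ perp b₁ F) =>
      Lset b₁ p.1 p.2 := by
  rintro ⟨F, φ⟩ ⟨G, ψ⟩ (h : Lset b₁ F φ = Lset b₁ G ψ)
  obtain rfl : F = G := by
    have hL : lagrangianOf b₁ F φ = lagrangianOf b₁ G ψ := SetLike.coe_injective h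
    rw [← map_fst_lagrangianOf b₁ F φ, hL, map_fst_lagrangianOf]
  obtain rfl : φ = ψ := by
    ext f
    obtain ⟨v, hv⟩ := Submodule.Quotient.mk_surjective _ (φ f)
    have hmem : ((f : V), v) ∈ Lset b₁ F φ := ⟨f.2, hv⟩
    rw [h] at hmem
    exact hv.symm.trans hmem.2
  rfl

/-- A subspace `L` of `V × V` meeting `0 × V` in `0 × F^⊥`, where `F` is the first projection of
`L`, is of the form `L_{F,φ}`. -/
lemma exists_eq_Lset {b₁ : V →ₗ[K] V →ₗ[K] K} {L : Submodule K (V × V)}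
    (hL : L.comap (LinearMap.inr K V V) = perp b₁ (L.map (LinearMap.fst K V V))) :
    ∃ φ : ↥(L.map (LinearMap.fst K V V)) →ₗ[K] V ⧸ perp b₁ (L.map (LinearMap.fst K V V)),
      (L : Set (V × V)) = Lset b₁ (L.map (LinearMap.fst K V V)) φ := by
  set F := L.map (LinearMap.fst K V V)
  have hex : ∀ f : F, ∃ v : V, ((f : V), v) ∈ L := by
    rintro ⟨_, ⟨a, v⟩, h, rfl⟩
    exact ⟨v, h⟩
  choose s hs using hex
  have key : ∀ (f : F) (v : V),
      ((f : V), v) ∈ L ↔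
        (Submodule.Quotient.mk v : V ⧸ perp b₁ F) = Submodule.Quotient.mk (s f) := by
    intro f v
    rw [Submodule.Quotient.eq, ← hL, Submodule.mem_comap, ← L.sub_mem_iff_left (hs f)]
    simp
  refine ⟨{ toFun := fun f => Submodule.Quotient.mk (s f), map_add' := ?_, map_smul' := ?_ }, ?_⟩
  · intro f g
    exact ((key (f + g) (s f + s g)).1 (L.add_mem (hs f) (hs g))).symm
  · intro c f
    exact ((key (c • f) (c • s f)).1 (L.smul_mem c (hs f))).symm
  · ext x
    constructor
    · intro hx
      exact ⟨⟨x, hx, rfl⟩, (key ⟨x.1, _⟩ x.2).1 hx⟩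
    · rintro ⟨hx, hx'⟩
      exact (key ⟨x.1, hx⟩ x.2).2 hx'

end

theorem stmt12 {K V : Type*} [Field K] [AddCommGroup V] [Module K V] [FiniteDimensional K V]
    (hchar : (2 : K) ≠ 0)
    (b₁ : V →ₗ[K] V →ₗ[K] K)
    (hsymm : ∀ v w : V, b₁ v w = b₁ w v)
    (hnd : ∀ v : V, (∀ w : V, b₁ v w = 0) → v = 0) :
    -- (i) each pair (F, φ) yields a Lagrangian submodule, and dim F ≤ ⌊r/2⌋
    (∀ (F : Submodule K V) (φ : ↥F →ₗ[K] V ⧸ perp b₁ F),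
      (∀ f ∈ F, ∀ f' ∈ F, b₁ f f' = 0) → φ ∈ Skew b₁ F →
      (∃ L : Submodule K (V × V),
        (L : Set (V × V)) = Lset b₁ F φ
        ∧ (∀ x ∈ L, eps K V x ∈ L)
        ∧ (∀ x ∈ L, ∀ y ∈ L, b2 b₁ x y = 0)
        ∧ Module.finrank K L = Module.finrank K V)
      ∧ Module.finrank K F ≤ Module.finrank K V / 2)
    -- (ii) every Lagrangian submodule comes from a unique pair (F, φ)
    ∧ (∀ L : Submodule K (V × V),
        (∀ x ∈ L, eps K V x ∈ L) →
        (∀ x ∈ L, ∀ y ∈ L, b2 b₁ x y = 0) →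
        Module.finrank K L = Module.finrank K V →
        ∃! p : (F : Submodule K V) × (↥F →ₗ[K] V ⧸ perp b₁ F),
          (∀ f ∈ p.1, ∀ f' ∈ p.1, b₁ f f' = 0)
          ∧ p.2 ∈ Skew b₁ p.1
          ∧ (L : Set (V × V)) = Lset b₁ p.1 p.2) := by
  refine ⟨fun F φ hF hφ => ⟨⟨lagrangianOf b₁ F φ, rfl, ?_, ?_, ?_⟩, ?_⟩, fun L heps hb hdim => ?_⟩
  · rintro x ⟨hx, -⟩
    change x.1 ∈ (lagrangianOf b₁ F φ).comap (LinearMap.inr K V V)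
    rw [comap_inr_lagrangianOf]
    exact hF x.1 hx
  · rintro x ⟨hx, hx'⟩ y ⟨hy, hy'⟩
    refine b2_eq_zero_iff.2 ⟨hF _ hx _ hy, ?_⟩
    have h := hφ ⟨x.1, hx⟩ ⟨y.1, hy⟩ x.2 y.2 hx' hy'
    rw [hsymm x.1 y.2, h, add_neg_cancel]
  · exact finrank_lagrangianOf hsymm hnd F φ
  · have hle : Module.finrank K F ≤ Module.finrank K (perp b₁ F) :=
      Submodule.finrank_mono hF
    have h := finrank_add_finrank_perp hsymm hnd F
    omega
  · have hP : L.comap (LinearMap.inr K V V) = perp b₁ (L.map (LinearMap.fst K V V)) := by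
      refine Submodule.eq_of_le_of_finrank_eq ?_ ?_
      · rintro v hv _ ⟨x, hx, rfl⟩
        simpa using (b2_eq_zero_iff.1 (hb _ hv x hx)).2
      · have h₁ := finrank_map_fst_add_finrank_comap_inr L
        have h₂ := finrank_add_finrank_perp hsymm hnd (L.map (LinearMap.fst K V V))
        omega
    obtain ⟨φ, hφ⟩ := exists_eq_Lset hP
    refine ⟨⟨_, φ⟩, ⟨?_, ?_, hφ⟩, fun q hq => Lset_injective b₁ (hq.2.2.symm.trans hφ)⟩
    · rintro _ ⟨x, hx, rfl⟩ _ ⟨y, hy, rfl⟩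
      exact (b2_eq_zero_iff.1 (hb x hx y hy)).1
    · intro f f' v v' hv hv'
      have hx : ((f : V), v) ∈ (L : Set (V × V)) := hφ ▸ ⟨f.2, hv⟩
      have hy : ((f' : V), v') ∈ (L : Set (V × V)) := hφ ▸ ⟨f'.2, hv'⟩
      have h := (b2_eq_zero_iff.1 (hb _ hx _ hy)).2
      rw [hsymm v' f]
      exact eq_neg_of_add_eq_zero_right h
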